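/- Every left special trapezoidal word over {a,b} is Sturmian. (A trapezoidal word w is left special if both aw and bw are trapezoidal.) -/

import Mathlib

/-- The two-letter alphabet {a, b}. -/
inductive AB : Type
  | a : AB
  | b : AB
deriving DecidableEq, Repr

/-- A (finite) word over {a, b}. -/
abbrev Word := List AB

open AB

/-- `u` occurs in `w` at position `i`. -/
def OccursAt (u w : Word) (i : ℕ) : Prop :=
  i + u.length ≤ w.length ∧ (w.drop i).take u.length = u

/-- `u` occurs exactly once in `w` (is unrepeated in `w`). -/
def OccursOnce (u w : Word) : Prop := ∃! i, OccursAt u w i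

/-- `u` is a right special factor of `w`: both `ua` and `ub` are factors of `w`. -/
def IsRightSpecial (u w : Word) : Prop := (u ++ [a]) <:+: w ∧ (u ++ [b]) <:+: w

/-- `u` is a left special factor of `w`: both `au` and `bu` are factors of `w`. -/
def IsLeftSpecial (u w : Word) : Prop := ([a] ++ u) <:+: w ∧ ([b] ++ u) <:+: w

/-- `K w`: the length of the shortest unrepeated suffix of `w`. -/
noncomputable def Kp (w : Word) : ℕ := sInf {n | ∃ s : Word, s <:+ w ∧ s.length = n ∧ OccursOnce s w}

/-- `H w`: the length of the shortest unrepeated prefix of `w`. -/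
noncomputable def Hp (w : Word) : ℕ := sInf {n | ∃ p : Word, p <+: w ∧ p.length = n ∧ OccursOnce p w}

/-- `R w`: the smallest `n ≥ 0` such that `w` has no right special factor of length `n`. -/
noncomputable def Rp (w : Word) : ℕ := sInf {n | ∀ u : Word, u.length = n → ¬ IsRightSpecial u w}

/-- `L w`: the smallest `n ≥ 0` such that `w` has no left special factor of length `n`. -/
noncomputable def Lp (w : Word) : ℕ := sInf {n | ∀ u : Word, u.length = n → ¬ IsLeftSpecial u w}

/-- A word `w` is trapezoidal if `|w| = K w + R w`. -/
def IsTrapezoidal (w : Word) : Prop := w.length = Kp w + Rp w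

/-- A finite word over `{a,b}` is Sturmian iff it is balanced: there is no word `u`
with both `aua` and `bub` factors of `w`. -/
def IsSturmian (w : Word) : Prop :=
  ¬ ∃ u : Word, ([a] ++ u ++ [a]) <:+: w ∧ ([b] ++ u ++ [b]) <:+: w

/-- A nonempty word is closed if it has a border (a proper prefix which is also a suffix)
whose only occurrences in `w` are as a prefix and as a suffix. -/
def IsClosedWord (w : Word) : Prop :=
  w ≠ [] ∧ ∃ v : Word, v <+: w ∧ v.length < w.length ∧ v <:+ w ∧
    ∀ i : ℕ, OccursAt v w i → i = 0 ∨ i + v.length = w.length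

/-- A nonempty word is open if it is not closed. -/
def IsOpenWord (w : Word) : Prop := w ≠ [] ∧ ¬ IsClosedWord w

/-- Central words: `a^n`, `b^n`, or `u a b v = v b a u`. -/
def IsCentral (w : Word) : Prop :=
  (∃ n : ℕ, w = List.replicate n a) ∨ (∃ n : ℕ, w = List.replicate n b) ∨
  (∃ u v : Word, w = u ++ [a, b] ++ v ∧ w = v ++ [b, a] ++ u)

/-- The minimal period of `w`: `|w|` minus the length of the longest border of `w`. -/
noncomputable def minPeriod (w : Word) : ℕ :=
  w.length - sSup {n | ∃ v : Word, v.length = n ∧ v <+: w ∧ v ≠ w ∧ v <:+ w}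

/-- The length-`k` blocks of `f` starting at `i` and `j` coincide. -/
def SameBlock (f : ℕ → AB) (k i j : ℕ) : Prop := ∀ t < k, f (i + t) = f (j + t)

/-- Among the first `N` letters of `f`, there is at most one right special factor of each length. -/
def RightUnique (f : ℕ → AB) (N : ℕ) : Prop :=
  ∀ k i i' j j', i + k < N → i' + k < N → j + k < N → j' + k < N →
    SameBlock f k i i' → f (i + k) ≠ f (i' + k) →
    SameBlock f k j j' → f (j + k) ≠ f (j' + k) → SameBlock f k i j

/-- Among the first `N` letters of `f`, there is at most one left special factor of each length. -/
def LeftUnique (f : ℕ → AB) (N : ℕ) : Prop :=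
  ∀ k i i' j j', i + k < N → i' + k < N → j + k < N → j' + k < N →
    SameBlock f k (i + 1) (i' + 1) → f i ≠ f i' →
    SameBlock f k (j + 1) (j' + 1) → f j ≠ f j' → SameBlock f k (i + 1) (j + 1)

/-- Some word `u` of length `m` has both `aua` and `bub` as factors of the first `N` letters
of `f`. -/
def UnbalancedAt (f : ℕ → AB) (N m : ℕ) : Prop :=
  ∃ p q, p + m + 2 ≤ N ∧ q + m + 2 ≤ N ∧ f (p + m + 1) = f p ∧ f (q + m + 1) = f q ∧
    f p ≠ f q ∧ SameBlock f m (p + 1) (q + 1)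

theorem AB.eq_of_ne_of_ne {x y z : AB} (h : x ≠ z) (h' : y ≠ z) : x = y := by
  cases x <;> cases y <;> cases z <;> simp_all

theorem SameBlock.symm {f : ℕ → AB} {k i j : ℕ} (h : SameBlock f k i j) : SameBlock f k j i :=
  fun t ht => (h t ht).symm

theorem SameBlock.trans {f : ℕ → AB} {k i j l : ℕ} (h : SameBlock f k i j)
    (h' : SameBlock f k j l) : SameBlock f k i l :=
  fun t ht => (h t ht).trans (h' t ht)

theorem SameBlock.cons {f : ℕ → AB} {k i j : ℕ} (h : SameBlock f k (i + 1) (j + 1))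
    (h' : f i = f j) : SameBlock f (k + 1) i j := by
  rintro (_ | t) ht
  · exact h'
  · have := h t (by omega)
    rwa [add_right_comm, add_right_comm j] at this

theorem SameBlock.concat {f : ℕ → AB} {k i j : ℕ} (h : SameBlock f k i j)
    (h' : f (i + k) = f (j + k)) : SameBlock f (k + 1) i j := by
  intro t ht
  rcases Nat.lt_succ_iff_lt_or_eq.mp ht with ht | rfl
  exacts [h t ht, h']

theorem SameBlock.mono {f : ℕ → AB} {k l i j : ℕ} (h : SameBlock f k i j) (hl : l ≤ k) :
    SameBlock f l i j := fun t ht => h t (by omega)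

theorem SameBlock.tail {f : ℕ → AB} {k i j : ℕ} (h : SameBlock f (k + 1) i j) :
    SameBlock f k (i + 1) (j + 1) := by
  intro t ht
  have := h (t + 1) (by omega)
  rwa [add_right_comm, add_right_comm j]

theorem RightUnique.leftUnique {f : ℕ → AB} {N : ℕ} (h : RightUnique f N) : LeftUnique f N := by
  intro k
  induction k with
  | zero => intro i i' j j' _ _ _ _ _ _ _ _ t ht; omega
  | succ k ih =>
    have key : ∀ i i' j j', i + (k + 1) < N → i' + (k + 1) < N → j + (k + 1) < N →
        j' + (k + 1) < N → SameBlock f (k + 1) (i + 1) (i' + 1) → f i ≠ f i' →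
        SameBlock f (k + 1) (j + 1) (j' + 1) → f j ≠ f j' → f i = f j →
        SameBlock f (k + 1) (i + 1) (j + 1) := by
      intro i i' j j' hi hi' hj hj' e ne e' ne' hij
      have e0 := ih i i' j j' (by omega) (by omega) (by omega) (by omega)
        (e.mono (by omega)) ne (e'.mono (by omega)) ne'
      by_contra hc
      have hne : f (i + 1 + k) ≠ f (j + 1 + k) := fun hh => hc (e0.concat hh)
      have hij' : f i' = f j' := AB.eq_of_ne_of_ne ne.symm (hij ▸ ne'.symm)
      have e1 : SameBlock f k (i' + 1) (j' + 1) :=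
        ((e.mono (by omega)).symm.trans e0).trans (e'.mono (by omega))
      have a1 := e k (by omega)
      have a2 := e' k (by omega)
      have hx : ∀ x, x + 1 + k = x + (k + 1) := fun x => by omega
      simp only [hx] at a1 a2 hne
      exact ne (h (k + 1) i j i' j' hi hj hi' hj' (e0.cons hij) hne (e1.cons hij')
        (by rwa [← a1, ← a2]) 0 (by omega))
    intro i i' j j' hi hi' hj hj' e ne e' ne'
    by_cases hij : f i = f j
    · exact key i i' j j' hi hi' hj hj' e ne e' ne' hij
    · exact (key i i' j' j hi hi' hj' hj e ne e'.symm ne'.symm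
        (AB.eq_of_ne_of_ne hij ne'.symm)).trans e'.symm

/-! ### Counting factors -/

/-- The length-`k` block of `f` starting at `i`. -/
def block (f : ℕ → AB) (k i : ℕ) : Word := (List.range k).map fun t => f (i + t)

theorem block_eq_iff {f : ℕ → AB} {k i j : ℕ} :
    block f k i = block f k j ↔ SameBlock f k i j := by
  simp [block, SameBlock]

theorem block_succ (f : ℕ → AB) (k i : ℕ) : block f (k + 1) i = block f k i ++ [f (i + k)] := by
  simp [block, List.range_succ]

/-- The factors of length `k` of the first `N` letters of `f`. -/
def factors (f : ℕ → AB) (N k : ℕ) : Finset Word :=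
  (Finset.range (N + 1 - k)).image (block f k)

/-- The factors of length `k` of the first `N` letters of `f` with an occurrence followed
by `c`. -/
def followedBy (f : ℕ → AB) (N : ℕ) (c : AB) (k : ℕ) : Finset Word :=
  ((Finset.range (N - k)).filter fun i => f (i + k) = c).image (block f k)

theorem card_factors_succ (f : ℕ → AB) (N k : ℕ) :
    (factors f N (k + 1)).card
      = (followedBy f N AB.a k ∪ followedBy f N AB.b k).card
        + (followedBy f N AB.a k ∩ followedBy f N AB.b k).card := by
  rw [Finset.card_union_add_card_inter]
  have hF : factors f N (k + 1) = (followedBy f N AB.a k).image (· ++ [AB.a])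
      ∪ (followedBy f N AB.b k).image (· ++ [AB.b]) := by
    ext u
    simp only [factors, followedBy, Finset.mem_image, Finset.mem_union, Finset.mem_range,
      Finset.mem_filter, block_succ]
    constructor
    · rintro ⟨i, hi, rfl⟩
      cases hc : f (i + k)
      · exact .inl ⟨_, ⟨i, ⟨by omega, hc⟩, rfl⟩, rfl⟩
      · exact .inr ⟨_, ⟨i, ⟨by omega, hc⟩, rfl⟩, rfl⟩
    · rintro (⟨_, ⟨i, ⟨hi, hc⟩, rfl⟩, rfl⟩ | ⟨_, ⟨i, ⟨hi, hc⟩, rfl⟩, rfl⟩) <;>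
        exact ⟨i, by omega, by rw [hc]⟩
  have hd : Disjoint ((followedBy f N AB.a k).image (· ++ [AB.a]))
      ((followedBy f N AB.b k).image (· ++ [AB.b])) := by
    rw [Finset.disjoint_left]
    intro u hu hu'
    simp only [Finset.mem_image] at hu hu'
    obtain ⟨x, -, rfl⟩ := hu
    obtain ⟨y, -, hy⟩ := hu'
    simpa using (List.append_inj' hy rfl).2
  rw [hF, Finset.card_union_of_disjoint hd,
    Finset.card_image_of_injective _ (List.append_left_injective _),
    Finset.card_image_of_injective _ (List.append_left_injective _)]

theorem union_followedBy_subset (f : ℕ → AB) (N k : ℕ) :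
    followedBy f N AB.a k ∪ followedBy f N AB.b k ⊆ factors f N k := by
  intro u hu
  simp only [followedBy, factors, Finset.mem_union, Finset.mem_image, Finset.mem_filter,
    Finset.mem_range] at hu ⊢
  rcases hu with ⟨i, ⟨hi, -⟩, rfl⟩ | ⟨i, ⟨hi, -⟩, rfl⟩ <;> exact ⟨i, by omega, rfl⟩

theorem block_mem_union_followedBy {f : ℕ → AB} {N k i : ℕ} (hi : i < N - k) :
    block f k i ∈ followedBy f N AB.a k ∪ followedBy f N AB.b k := by
  simp only [followedBy, Finset.mem_union, Finset.mem_image, Finset.mem_filter, Finset.mem_range]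
  cases hc : f (i + k)
  · exact .inl ⟨i, ⟨hi, hc⟩, rfl⟩
  · exact .inr ⟨i, ⟨hi, hc⟩, rfl⟩

theorem factors_subset_insert (f : ℕ → AB) (N k : ℕ) :
    factors f N k ⊆ insert (block f k (N - k))
      (followedBy f N AB.a k ∪ followedBy f N AB.b k) := by
  intro u hu
  simp only [factors, Finset.mem_image, Finset.mem_range] at hu
  obtain ⟨i, hi, rfl⟩ := hu
  rw [Finset.mem_insert]
  by_cases h : i = N - k
  · exact .inl (by rw [h])
  · exact .inr (block_mem_union_followedBy (by omega))

theorem mem_inter_followedBy {f : ℕ → AB} {N k : ℕ} {u : Word} :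
    u ∈ followedBy f N AB.a k ∩ followedBy f N AB.b k ↔
      ∃ i i', i + k < N ∧ i' + k < N ∧ f (i + k) = AB.a ∧ f (i' + k) = AB.b ∧
        block f k i = u ∧ block f k i' = u := by
  simp only [followedBy, Finset.mem_inter, Finset.mem_image, Finset.mem_filter, Finset.mem_range]
  constructor
  · rintro ⟨⟨i, ⟨hi, hc⟩, h⟩, ⟨i', ⟨hi', hc'⟩, h'⟩⟩
    exact ⟨i, i', by omega, by omega, hc, hc', h, h'⟩
  · rintro ⟨i, i', hi, hi', hc, hc', h, h'⟩
    exact ⟨⟨i, ⟨by omega, hc⟩, h⟩, ⟨i', ⟨by omega, hc'⟩, h'⟩⟩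

theorem RightUnique.card_factors_le {f : ℕ → AB} {N : ℕ} (h : RightUnique f N) (k : ℕ) :
    (factors f N k).card ≤ k + 1 := by
  induction k with
  | zero =>
    refine Finset.card_le_one.mpr fun x hx y hy => ?_
    simp only [factors, Finset.mem_image, block, List.range_zero, List.map_nil] at hx hy
    obtain ⟨-, -, rfl⟩ := hx
    obtain ⟨-, -, rfl⟩ := hy
    rfl
  | succ k ih =>
    rw [card_factors_succ]
    have h1 := Finset.card_le_card (union_followedBy_subset f N k)
    have h2 : (followedBy f N AB.a k ∩ followedBy f N AB.b k).card ≤ 1 := by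
      refine Finset.card_le_one.mpr fun x hx y hy => ?_
      obtain ⟨i, i', hi, hi', hc, hc', rfl, he⟩ := mem_inter_followedBy.mp hx
      obtain ⟨j, j', hj, hj', hd, hd', rfl, he'⟩ := mem_inter_followedBy.mp hy
      exact block_eq_iff.mpr (h k i i' j j' hi hi' hj hj' (block_eq_iff.mp he.symm)
        (by simp [hc, hc']) (block_eq_iff.mp he'.symm) (by simp [hd, hd']))
    omega

/-! ### Trapezoidal words have unique special factors -/

/-- The letters of `w`, as a function on `ℕ`. -/
def letters (w : Word) (i : ℕ) : AB := w.getD i AB.a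

theorem block_letters {w : Word} {k i : ℕ} (h : i + k ≤ w.length) :
    block (letters w) k i = (w.drop i).take k := by
  apply List.ext_getElem
  · simp [block]; omega
  · intro t h1 h2
    have : t < k := by simpa [block] using h1
    simp [block, letters, List.getD_eq_getElem?_getD,
      List.getElem?_eq_getElem (l := w) (i := i + t) (by omega)]

theorem occursAt_iff_block {w u : Word} {i : ℕ} :
    OccursAt u w i ↔ i + u.length ≤ w.length ∧ block (letters w) u.length i = u := by
  unfold OccursAt
  exact and_congr_right fun h => by rw [block_letters h]

theorem isInfix_iff_block {w u : Word} :
    u <:+: w ↔ ∃ i, i + u.length ≤ w.length ∧ block (letters w) u.length i = u := by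
  constructor
  · rintro ⟨s, t, rfl⟩
    refine ⟨s.length, by simp, ?_⟩
    rw [block_letters (by simp)]
    simp
  · rintro ⟨i, hi, h⟩
    rw [block_letters hi] at h
    rw [← h]
    exact (List.take_prefix _ _).isInfix.trans (List.drop_suffix _ _).isInfix

theorem isRightSpecial_iff_mem {w u : Word} :
    IsRightSpecial u w ↔ u ∈ followedBy (letters w) w.length AB.a u.length
      ∩ followedBy (letters w) w.length AB.b u.length := by
  rw [mem_inter_followedBy]
  simp only [IsRightSpecial, isInfix_iff_block, List.length_append, List.length_singleton,
    block_succ]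
  constructor
  · rintro ⟨⟨i, hi, h⟩, ⟨i', hi', h'⟩⟩
    have h1 := List.append_inj' h rfl
    have h2 := List.append_inj' h' rfl
    exact ⟨i, i', by omega, by omega, by simpa using h1.2, by simpa using h2.2, h1.1, h2.1⟩
  · rintro ⟨i, i', hi, hi', hc, hc', h, h'⟩
    exact ⟨⟨i, by omega, by rw [h, hc]⟩, ⟨i', by omega, by rw [h', hc']⟩⟩

theorem Kp_le_length (w : Word) : Kp w ≤ w.length := by
  apply Nat.sInf_le
  refine ⟨w, List.suffix_refl w, rfl, 0, ⟨by simp, by simp⟩, ?_⟩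
  rintro i ⟨hi, -⟩
  omega

theorem block_suffix_mem_of_lt_Kp {w : Word} {k : ℕ} (hk : k < Kp w) :
    block (letters w) k (w.length - k) ∈ followedBy (letters w) w.length AB.a k
      ∪ followedBy (letters w) w.length AB.b k := by
  have hkw := hk.trans_le (Kp_le_length w)
  have hn := Nat.notMem_of_lt_sInf hk
  by_contra hc
  have hb : block (letters w) k (w.length - k) = w.drop (w.length - k) := by
    rw [block_letters (by omega)]
    exact List.take_of_length_le (by simp; omega)
  have hl : (w.drop (w.length - k)).length = k := by simp; omega
  refine hn ⟨w.drop (w.length - k), List.drop_suffix _ _, hl, w.length - k, ?_, ?_⟩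
  · refine occursAt_iff_block.mpr ⟨by omega, by rw [hl, hb]⟩
  · intro i hi
    obtain ⟨hi, h⟩ := occursAt_iff_block.mp hi
    rw [hl] at hi h
    by_contra hne
    rw [hb, ← h] at hc
    exact hc (block_mem_union_followedBy (by omega))

theorem card_factors_add_le (w : Word) (k : ℕ) :
    (factors (letters w) w.length k).card
        + (followedBy (letters w) w.length AB.a k ∩ followedBy (letters w) w.length AB.b k).card
      ≤ (factors (letters w) w.length (k + 1)).card + if Kp w ≤ k then 1 else 0 := by
  rw [card_factors_succ]
  have h1 := Finset.card_le_card (factors_subset_insert (letters w) w.length k)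
  split_ifs with hk
  · have := Finset.card_insert_le (block (letters w) k (w.length - k))
      (followedBy (letters w) w.length AB.a k ∪ followedBy (letters w) w.length AB.b k)
    omega
  · rw [Finset.insert_eq_of_mem (block_suffix_mem_of_lt_Kp (by omega))] at h1
    omega

theorem sum_card_rightSpecial_add_Kp_le (w : Word) :
    ∑ k ∈ Finset.range w.length, (followedBy (letters w) w.length AB.a k
      ∩ followedBy (letters w) w.length AB.b k).card + Kp w ≤ w.length := by
  have key : ∀ m, (factors (letters w) w.length 0).card
      + ∑ k ∈ Finset.range m, (followedBy (letters w) w.length AB.a k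
        ∩ followedBy (letters w) w.length AB.b k).card
      ≤ (factors (letters w) w.length m).card + (m - Kp w) := by
    intro m
    induction m with
    | zero => simp
    | succ m ih =>
      rw [Finset.sum_range_succ]
      have := card_factors_add_le w m
      split_ifs at this <;> omega
  have h := key w.length
  have h0 : 0 < (factors (letters w) w.length 0).card :=
    Finset.card_pos.mpr ⟨block (letters w) 0 0, Finset.mem_image_of_mem _ (by simp)⟩
  have h1 : (factors (letters w) w.length w.length).card ≤ 1 := by
    refine Finset.card_image_le.trans ?_
    simp
  have := Kp_le_length w
  omega

theorem IsTrapezoidal.rightUnique {w : Word} (h : IsTrapezoidal w) :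
    RightUnique (letters w) w.length := by
  set S : ℕ → Finset Word := fun k => followedBy (letters w) w.length AB.a k
    ∩ followedBy (letters w) w.length AB.b k with hS
  have hsum : ∑ k ∈ Finset.range w.length, (S k).card + Kp w ≤ w.length :=
    sum_card_rightSpecial_add_Kp_le w
  have hpos : ∀ k < Rp w, 1 ≤ (S k).card := by
    intro k hk
    have hn := Nat.notMem_of_lt_sInf hk
    simp only [Set.mem_ofPred_eq, not_forall, not_not] at hn
    obtain ⟨u, rfl, hu⟩ := hn
    exact Finset.card_pos.mpr ⟨u, isRightSpecial_iff_mem.mp hu⟩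
  have hle : ∀ k < w.length, (S k).card ≤ 1 := by
    intro k hk
    by_contra! hc
    have hlt : ∑ j ∈ Finset.range w.length, (if j < Rp w then 1 else 0)
        < ∑ j ∈ Finset.range w.length, (S j).card := by
      refine Finset.sum_lt_sum (fun j _ => ?_) ⟨k, Finset.mem_range.mpr hk, ?_⟩
      · split_ifs with hj
        exacts [hpos j hj, Nat.zero_le _]
      · split_ifs <;> omega
    have hR : ∑ j ∈ Finset.range w.length, (if j < Rp w then 1 else 0) = Rp w := by
      have hRw : Rp w ≤ w.length := by unfold IsTrapezoidal at h; omega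
      rw [← Finset.card_filter]
      have : (Finset.range w.length).filter (· < Rp w) = Finset.range (Rp w) := by
        ext x; simp; omega
      rw [this, Finset.card_range]
    unfold IsTrapezoidal at h
    omega
  have mem : ∀ k i i', i + k < w.length → i' + k < w.length → SameBlock (letters w) k i i' →
      letters w (i + k) ≠ letters w (i' + k) → block (letters w) k i ∈ S k := by
    intro k i i' hi hi' e ne
    have e' := block_eq_iff.mpr e.symm
    refine mem_inter_followedBy.mpr ?_
    cases hc : letters w (i + k) <;> cases hc' : letters w (i' + k)
    · simp_all
    · exact ⟨i, i', hi, hi', hc, hc', rfl, e'⟩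
    · exact ⟨i', i, hi', hi, hc', hc, e', rfl⟩
    · simp_all
  intro k i i' j j' hi hi' hj hj' e ne e' ne'
  exact block_eq_iff.mp (Finset.card_le_one.mp (hle k (by omega)) _ (mem k i i' hi hi' e ne) _
    (mem k j j' hj hj' e' ne'))

/-! ### Counting letters -/

/-- The number of occurrences of `c` in the length-`d` block of `f` starting at `i`. -/
def letterCount (f : ℕ → AB) (c : AB) (d i : ℕ) : ℕ :=
  ∑ t ∈ Finset.range d, if f (i + t) = c then 1 else 0

theorem letterCount_succ (f : ℕ → AB) (c : AB) (d i : ℕ) :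
    letterCount f c (d + 1) i = letterCount f c d i + if f (i + d) = c then 1 else 0 := by
  simp only [letterCount, Finset.sum_range_succ]

theorem letterCount_succ' (f : ℕ → AB) (c : AB) (d i : ℕ) :
    letterCount f c (d + 1) i = (if f i = c then 1 else 0) + letterCount f c d (i + 1) := by
  simp only [letterCount, Finset.sum_range_succ']
  rw [add_comm, add_zero]
  congr 1
  refine Finset.sum_congr rfl fun t _ => ?_
  rw [add_right_comm, add_assoc]

theorem letterCount_congr {f : ℕ → AB} {c : AB} {d i j : ℕ} (h : SameBlock f d i j) :
    letterCount f c d i = letterCount f c d j :=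
  Finset.sum_congr rfl fun t ht => by rw [h t (Finset.mem_range.mp ht)]

theorem exists_unbalancedAt_of_letterCount {f : ℕ → AB} {N : ℕ} {c : AB} {d i j : ℕ}
    (hi : i + d ≤ N) (hj : j + d ≤ N)
    (h : letterCount f c d j + 2 ≤ letterCount f c d i) :
    ∃ m, m + 2 ≤ d ∧ UnbalancedAt f N m := by
  have key : ∀ e ≤ d,
      (letterCount f c e j + 2 ≤ letterCount f c e i → ∃ m, m + 2 ≤ e ∧ UnbalancedAt f N m) ∧
      (letterCount f c e j + 1 ≤ letterCount f c e i → (∃ m, m + 2 ≤ e ∧ UnbalancedAt f N m) ∨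
        ∃ t < e, f (i + t) = c ∧ f (j + t) ≠ c ∧
          ∀ s, t < s → s < e → f (i + s) = f (j + s)) := by
    intro e
    induction e with
    | zero => intro _; simp [letterCount]
    | succ e ih =>
      intro he
      obtain ⟨ih2, ih1⟩ := ih (by omega)
      have up : (∃ m, m + 2 ≤ e ∧ UnbalancedAt f N m) → ∃ m, m + 2 ≤ e + 1 ∧ UnbalancedAt f N m :=
        fun ⟨m, hm, hu⟩ => ⟨m, by omega, hu⟩
      by_cases h2 : letterCount f c e j + 2 ≤ letterCount f c e i
      · exact ⟨fun _ => up (ih2 h2), fun _ => .inl (up (ih2 h2))⟩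
      · have two : letterCount f c (e + 1) j + 2 ≤ letterCount f c (e + 1) i →
            ∃ m, m + 2 ≤ e + 1 ∧ UnbalancedAt f N m := by
          intro hh
          rw [letterCount_succ, letterCount_succ] at hh
          have hic : f (i + e) = c := by by_contra hx; rw [if_neg hx] at hh; omega
          have hjc : f (j + e) ≠ c := by
            intro hx; rw [if_pos hx, if_pos hic] at hh; omega
          rw [if_pos hic, if_neg hjc] at hh
          rcases ih1 (by omega) with hu | ⟨t, ht, hit, hjt, hs⟩
          · exact up hu
          · refine ⟨e - t - 1, by omega, i + t, j + t, by omega, by omega, ?_, ?_, ?_, ?_⟩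
            · rw [show i + t + (e - t - 1) + 1 = i + e by omega, hic, hit]
            · rw [show j + t + (e - t - 1) + 1 = j + e by omega]
              exact AB.eq_of_ne_of_ne hjc hjt
            · rw [hit]; exact hjt.symm
            · intro s hs'
              have := hs (t + 1 + s) (by omega) (by omega)
              rwa [show i + t + 1 + s = i + (t + 1 + s) by omega,
                show j + t + 1 + s = j + (t + 1 + s) by omega]
        refine ⟨two, fun hh => ?_⟩
        by_cases h3 : letterCount f c (e + 1) j + 2 ≤ letterCount f c (e + 1) i
        · exact .inl (two h3)
        rw [letterCount_succ, letterCount_succ] at hh h3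
        by_cases h1 : letterCount f c e j + 1 ≤ letterCount f c e i
        · rcases ih1 h1 with hu | ⟨t, ht, hit, hjt, hs⟩
          · exact .inl (up hu)
          · refine .inr ⟨t, by omega, hit, hjt, fun s h1s h2s => ?_⟩
            rcases Nat.lt_succ_iff_lt_or_eq.mp h2s with h2s | rfl
            · exact hs s h1s h2s
            · by_cases hx : f (i + s) = c <;> by_cases hy : f (j + s) = c
              · rw [hx, hy]
              · rw [if_pos hx, if_neg hy] at h3; omega
              · rw [if_neg hx, if_pos hy] at hh; omega
              · exact AB.eq_of_ne_of_ne hx hy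
        · refine .inr ⟨e, by omega, ?_, ?_, fun s h1s h2s => by omega⟩
          · by_contra hx; rw [if_neg hx] at hh; omega
          · intro hx; rw [if_pos hx] at hh; split_ifs at hh <;> omega
  exact (key d le_rfl).1 h

/-! ### Complete returns of a minimal unbalanced factor -/

/-- If an unbalanced pair `aua`, `bub` has minimal length, then a return of `u` to itself of
length at most `|u|` starts and ends with the same letter. -/
theorem return_eq_of_le {f : ℕ → AB} {N n p q i d : ℕ}
    (hmin : ∀ m < n, ¬ UnbalancedAt f N m) (hp : p + n + 2 ≤ N) (hq : q + n + 2 ≤ N)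
    (hqf : f (q + n + 1) = f q) (hpq : f p ≠ f q)
    (he : SameBlock f n (p + 1) (q + 1)) (hi : SameBlock f n i (p + 1))
    (hid : SameBlock f n (i + d) (p + 1)) (hd : 0 < d) (hdn : d ≤ n)
    (hout : f (i + n) = f p) : f (i + n) = f (i + d - 1) := by
  by_contra hne
  have hper : SameBlock f n i (i + d) := hi.trans hid.symm
  have hshift : ∀ s ≤ n - d + 1, s ≤ n →
      letterCount f (f p) d (i + s) = letterCount f (f p) d i := by
    intro s
    induction s with
    | zero => simp
    | succ s ih =>
      intro h1 h2
      have e1 := letterCount_succ f (f p) d (i + s)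
      have e2 := letterCount_succ' f (f p) d (i + s)
      have e3 := hper s (by omega)
      rw [add_right_comm] at e3
      rw [← add_assoc, ← ih (by omega) (by omega)]
      rw [e1, e3] at e2
      omega
  obtain ⟨d, rfl⟩ : ∃ d', d = d' + 1 := ⟨d - 1, by omega⟩
  have c1 : letterCount f (f p) (d + 1) p = 1 + letterCount f (f p) d i := by
    rw [letterCount_succ', if_pos rfl, letterCount_congr (hi.mono (by omega : d ≤ n))]
  have c2 : letterCount f (f p) (d + 1) i = letterCount f (f p) d i := by
    rw [letterCount_succ, if_neg, add_zero]
    intro hx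
    exact hne (by rw [hout, ← hx]; rfl)
  have c3 : letterCount f (f p) (d + 1) (q + n + 1 - d)
      = letterCount f (f p) d (q + n + 1 - d) := by
    rw [letterCount_succ, if_neg, add_zero]
    rw [show q + n + 1 - d + d = q + n + 1 by omega, hqf]
    exact hpq.symm
  have c4 : letterCount f (f p) (d + 1) (i + (n - d - 1))
      = 1 + letterCount f (f p) d (q + n + 1 - d) := by
    rw [letterCount_succ', if_pos]
    · congr 1
      refine letterCount_congr fun t ht => ?_
      have := (hi.trans he) (n - d + t) (by omega)
      rwa [show i + (n - d - 1) + 1 + t = i + (n - d + t) by omega,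
        show q + n + 1 - d + t = q + 1 + (n - d + t) by omega]
    · have := hper (n - d - 1) (by omega)
      rw [this, ← hout]
      congr 1
      omega
  have c5 := hshift (n - d - 1) (by omega) (by omega)
  obtain ⟨m, hm, hu⟩ := exists_unbalancedAt_of_letterCount (f := f) (N := N) (c := f p)
    (d := d + 1) (i := p) (j := q + n + 1 - d) (by omega) (by omega) (by omega)
  exact hmin m (by omega) hu

/-- If an unbalanced pair `aua`, `bub` has minimal length, then every complete return of `u`
leaves the first occurrence of `u` with the letter by which it enters the second one. -/
theorem completeReturn_eq {f : ℕ → AB} {N n p q i j : ℕ} (hR : RightUnique f N)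
    (hmin : ∀ m < n, ¬ UnbalancedAt f N m) (hp : p + n + 2 ≤ N) (hq : q + n + 2 ≤ N)
    (hpf : f (p + n + 1) = f p) (hqf : f (q + n + 1) = f q) (hpq : f p ≠ f q)
    (he : SameBlock f n (p + 1) (q + 1)) (hi : SameBlock f n i (p + 1))
    (hj : SameBlock f n j (p + 1)) (hij : i < j) (hjN : j + n ≤ N)
    (hno : ∀ t, i < t → t < j → ¬ SameBlock f n t (p + 1)) : f (i + n) = f (j - 1) := by
  obtain ⟨d, rfl⟩ : ∃ d, j = i + d := ⟨j - i, by omega⟩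
  rcases Nat.lt_trichotomy d (n + 1) with hd | rfl | hd
  · by_cases hout : f (i + n) = f p
    · exact return_eq_of_le hmin hp hq hqf hpq he hi hj (by omega) (by omega) hout
    · exact return_eq_of_le hmin hq hp hpf hpq.symm he.symm (hi.trans he) (hj.trans he)
        (by omega) (by omega) (AB.eq_of_ne_of_ne hout hpq.symm)
  · rfl
  · exfalso
    have step : ∀ s t, s + n < N → t + n < N → SameBlock f n s t →
        ¬ SameBlock f n s (p + 1) → f (s + n) = f (t + n) := by
      intro s t hs ht e hns
      by_contra hne
      refine hns (hR n s t (p + 1) (q + 1) hs ht (by omega) (by omega) e hne he ?_)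
      rw [add_right_comm, add_right_comm q, hpf, hqf]
      exact hpq
    have hinj : ∀ s t, s < t → t < d → ¬ SameBlock f n (i + s) (i + t) := by
      intro s t hst htd e
      have hs0 : s ≠ 0 := by
        rintro rfl
        exact hno (i + t) (by omega) (by omega) (e.symm.trans hi)
      have hrun : ∀ r, t + r ≤ d → SameBlock f n (i + s + r) (i + t + r) := by
        intro r
        induction r with
        | zero => intro _; exact e
        | succ r ih =>
          intro hr
          have e' := ih (by omega)
          exact (e'.concat (step _ _ (by omega) (by omega) e'
            (hno _ (by omega) (by omega)))).tail
      have := hrun (d - t) (by omega)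
      rw [show i + t + (d - t) = i + d by omega] at this
      exact hno _ (by omega) (by omega) (this.trans hj)
    have hcard : d ≤ (factors f N n).card := by
      rw [← Finset.card_range d]
      refine Finset.card_le_card_of_injOn (fun s => block f n (i + s)) ?_ ?_
      · intro s hs
        have := Finset.mem_range.mp hs
        exact Finset.mem_image_of_mem _ (Finset.mem_range.mpr (by omega))
      · intro s hs t ht hst
        have hs := Finset.mem_range.mp hs
        have ht := Finset.mem_range.mp ht
        have e := block_eq_iff.mp hst
        rcases Nat.lt_trichotomy s t with h | h | h
        · exact absurd e (hinj s t h ht)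
        · exact h
        · exact absurd e.symm (hinj t s h hs)
    have := hR.card_factors_le n
    omega

theorem exists_next {P : ℕ → Prop} {i j : ℕ} (hij : i < j) (hj : P j) :
    ∃ l, i < l ∧ l ≤ j ∧ P l ∧ ∀ t, i < t → t < l → ¬ P t := by
  classical
  have hex : ∃ l, i < l ∧ P l := ⟨j, hij, hj⟩
  exact ⟨Nat.find hex, (Nat.find_spec hex).1, Nat.find_min' hex ⟨hij, hj⟩, (Nat.find_spec hex).2,
    fun t h1 h2 h3 => Nat.find_min hex h2 ⟨h1, h3⟩⟩

theorem exists_prev {P : ℕ → Prop} {i j : ℕ} (hij : i < j) (hi : P i) :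
    ∃ l, i ≤ l ∧ l < j ∧ P l ∧ ∀ t, l < t → t < j → ¬ P t := by
  induction j, hij using Nat.le_induction with
  | base => exact ⟨i, le_rfl, by omega, hi, fun t _ _ => by omega⟩
  | succ j hj ih =>
    by_cases h : P j
    · exact ⟨j, by omega, by omega, h, fun t _ _ => by omega⟩
    · obtain ⟨l, h1, h2, h3, h4⟩ := ih
      refine ⟨l, h1, by omega, h3, fun t ht ht' => ?_⟩
      rcases Nat.lt_succ_iff_lt_or_eq.mp ht' with ht' | rfl
      exacts [h4 t ht ht', h]

theorem SameBlock.shift {f g : ℕ → AB} (hg : ∀ i, g (i + 1) = f i) {k i j : ℕ}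
    (h : SameBlock f k i j) : SameBlock g k (i + 1) (j + 1) := by
  intro t ht
  rw [add_right_comm, add_right_comm j, hg, hg]
  exact h t ht

theorem SameBlock.of_shift {f g : ℕ → AB} (hg : ∀ i, g (i + 1) = f i) {k i j : ℕ}
    (h : SameBlock g k (i + 1) (j + 1)) : SameBlock f k i j := by
  intro t ht
  have := h t ht
  rwa [add_right_comm, add_right_comm j, hg, hg] at this

/-- If every one-letter extension to the left has unique right special factors, then the `u` of
a minimal unbalanced pair `aua`, `bub` is not a prefix. -/
theorem not_sameBlock_zero {f : ℕ → AB} {N n p q : ℕ} (hR : RightUnique f N)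
    (hext : ∀ c, ∃ g : ℕ → AB, g 0 = c ∧ (∀ i, g (i + 1) = f i) ∧ RightUnique g (N + 1))
    (hmin : ∀ m < n, ¬ UnbalancedAt f N m) (hp : p + n + 2 ≤ N) (hq : q + n + 2 ≤ N)
    (hpf : f (p + n + 1) = f p) (hqf : f (q + n + 1) = f q) (hpq : f p ≠ f q)
    (he : SameBlock f n (p + 1) (q + 1)) (h0 : f n = f p) : ¬ SameBlock f n 0 (p + 1) := by
  intro hz
  obtain ⟨j, hj0, hjq, ⟨hj, hjo⟩, hjmin⟩ := exists_next
    (P := fun j => SameBlock f n j (p + 1) ∧ f (j + n) = f q) (i := 0) (j := q + 1) (by omega)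
    ⟨he.symm, by rw [add_right_comm, hqf]⟩
  obtain ⟨i, -, hij, hi, hino⟩ := exists_prev (P := fun i => SameBlock f n i (p + 1)) hj0 hz
  have hio : f (i + n) = f p := by
    rcases Nat.eq_zero_or_pos i with rfl | hpos
    · rw [zero_add, h0]
    · exact AB.eq_of_ne_of_ne (fun hx => hjmin i hpos hij ⟨hi, hx⟩) hpq
  have hjin := completeReturn_eq hR hmin hp hq hpf hqf hpq he hi hj hij (by omega) hino
  obtain ⟨j, rfl⟩ : ∃ j', j = j' + 1 := ⟨j - 1, by omega⟩
  rw [hio, Nat.add_sub_cancel] at hjin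
  obtain ⟨g, hg0, hg, hgR⟩ := hext (f q)
  have h1 : SameBlock g (n + 1) (p + 1) (j + 1) :=
    (hj.symm.cons hjin).shift hg
  have h2 : SameBlock g (n + 1) 0 (q + 1) :=
    ((hz.trans he).shift hg).cons (by rw [hg0, hg])
  have hsucc : ∀ x, g (x + 1 + (n + 1)) = f (x + n + 1) := fun x => by
    rw [show x + 1 + (n + 1) = x + n + 1 + 1 by omega, hg]
  have h3 := hgR (n + 1) (p + 1) (j + 1) 0 (q + 1) (by omega) (by omega) (by omega) (by omega)
    h1 (by rw [hsucc, hsucc, hpf, ← add_right_comm j, hjo]; exact hpq)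
    h2 (by rw [hsucc, hqf, zero_add, hg, h0]; exact hpq) 0 (by omega)
  rw [add_zero, hg, hg0] at h3
  exact hpq h3

/-- If every one-letter extension to the left has unique special factors, then the letter before
the first occurrence of a bispecial factor `u` occurs before no other occurrence of `u`. -/
theorem ne_of_first_occurrence {f : ℕ → AB} {N n p q i j : ℕ} (hR : RightUnique f N)
    (hext : ∀ c, ∃ g : ℕ → AB, g 0 = c ∧ (∀ i, g (i + 1) = f i) ∧ RightUnique g (N + 1))
    (hp : p + n + 1 ≤ N) (hq : q + n + 1 ≤ N) (hpq : f p ≠ f q)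
    (he : SameBlock f n (p + 1) (q + 1)) (hj : SameBlock f n (j + 1) (p + 1))
    (hi : SameBlock f n (i + 1) (p + 1)) (hij : i < j) (hjN : j + n + 1 ≤ N)
    (hno : ∀ t ≤ i, ¬ SameBlock f n t (p + 1)) : f i ≠ f j := by
  intro hfij
  have hback : ∀ k ≤ i, SameBlock f n (i - k) (j - k) := by
    intro k
    induction k with
    | zero => exact fun _ => ((hi.trans hj.symm).cons hfij).mono (Nat.le_succ n)
    | succ k ih =>
      intro hk
      have e := ih (by omega)
      obtain ⟨x, hx⟩ : ∃ x, i - k = x + 1 := ⟨i - k - 1, by omega⟩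
      obtain ⟨y, hy⟩ : ∃ y, j - k = y + 1 := ⟨j - k - 1, by omega⟩
      rw [show i - (k + 1) = x by omega, show j - (k + 1) = y by omega]
      rw [hx, hy] at e
      by_cases hxy : f x = f y
      · exact (e.cons hxy).mono (by omega)
      · exact absurd (hR.leftUnique n x y p q (by omega) (by omega) (by omega) (by omega) e hxy
          he hpq) (hno _ (by omega))
  have e := hback i le_rfl
  obtain ⟨y, hy⟩ : ∃ y, j - i = y + 1 := ⟨j - i - 1, by omega⟩
  rw [Nat.sub_self, hy] at e
  obtain ⟨c, hc⟩ : ∃ c, c ≠ f y := by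
    cases f y
    exacts [⟨AB.b, by simp⟩, ⟨AB.a, by simp⟩]
  obtain ⟨g, hg0, hg, hgR⟩ := hext c
  have h := hgR.leftUnique n 0 (y + 1) (p + 1) (q + 1) (by omega) (by omega) (by omega) (by omega)
    (e.shift hg) (by rw [hg0, hg]; exact hc) (he.shift hg) (by rw [hg, hg]; exact hpq)
  exact hno 0 (by omega) (h.of_shift hg)

/-- If `f` and all its one-letter extensions to the left have unique right special factors, then
`f` is balanced. -/
theorem not_unbalancedAt {f : ℕ → AB} {N : ℕ} (hR : RightUnique f N)
    (hext : ∀ c, ∃ g : ℕ → AB, g 0 = c ∧ (∀ i, g (i + 1) = f i) ∧ RightUnique g (N + 1))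
    (n : ℕ) : ¬ UnbalancedAt f N n := by
  induction n using Nat.strong_induction_on with
  | _ n hmin =>
  classical
  rintro ⟨p, q, hp, hq, hpf, hqf, hpq, he⟩
  have hex : ∃ i, SameBlock f n i (p + 1) := ⟨p + 1, fun _ _ => rfl⟩
  have hfirst := Nat.find_spec hex
  have hbefore : ∀ t < Nat.find hex, ¬ SameBlock f n t (p + 1) := fun t => Nat.find_min hex
  have hip : Nat.find hex ≤ p + 1 := Nat.find_min' hex fun _ _ => rfl
  have hiq : Nat.find hex ≤ q + 1 := Nat.find_min' hex he.symm
  generalize Nat.find hex = i at hfirst hbefore hip hiq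
  rcases i with _ | i
  · by_cases h0 : f n = f p
    · exact not_sameBlock_zero hR hext hmin hp hq hpf hqf hpq he h0 hfirst
    · exact not_sameBlock_zero hR hext hmin hq hp hqf hpf hpq.symm he.symm
        (AB.eq_of_ne_of_ne h0 hpq.symm) (hfirst.trans he)
  · have hne : ∀ j, i < j → j + n + 1 ≤ N → SameBlock f n (j + 1) (p + 1) → f i ≠ f j :=
      fun j hij hjN hj => ne_of_first_occurrence hR hext (by omega) (by omega) hpq he hj hfirst hij
        hjN fun t ht => hbefore t (by omega)
    have hout : f (i + 1 + n) = f i ∧ ∃ j, i < j ∧ j + n + 1 ≤ N ∧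
        SameBlock f n (j + 1) (p + 1) := by
      rcases Nat.lt_or_ge i p with hlp | hlp
      · have hfp := hne p hlp (by omega) fun _ _ => rfl
        rcases Nat.lt_or_ge i q with hlq | hlq
        · exact absurd (AB.eq_of_ne_of_ne hfp.symm (hne q hlq (by omega) he.symm).symm) hpq
        · obtain rfl : i = q := by omega
          exact ⟨by rw [add_right_comm, hqf], p, hlp, by omega, fun _ _ => rfl⟩
      · obtain rfl : i = p := by omega
        have : i ≠ q := fun h => hpq (by rw [h])
        exact ⟨by rw [add_right_comm, hpf], q, by omega, by omega, he.symm⟩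
    obtain ⟨hout, j, hij, hjN, hj⟩ := hout
    obtain ⟨l, hil, hlj, hl, hlno⟩ := exists_next
      (P := fun l => SameBlock f n l (p + 1)) (i := i + 1) (j := j + 1) (by omega) hj
    have hret := completeReturn_eq hR hmin hp hq hpf hqf hpq he hfirst hl hil (by omega) hlno
    obtain ⟨l, rfl⟩ : ∃ l', l = l' + 1 := ⟨l - 1, by omega⟩
    rw [hout, Nat.add_sub_cancel] at hret
    exact hne l (by omega) (by omega) hl hret

theorem exists_position_of_isInfix {w u : Word} {c : AB} (h : ([c] ++ u ++ [c]) <:+: w) :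
    ∃ p, p + u.length + 2 ≤ w.length ∧ letters w p = c ∧ letters w (p + u.length + 1) = c ∧
      block (letters w) u.length (p + 1) = u := by
  obtain ⟨s, t, rfl⟩ := h
  refine ⟨s.length, by simp; omega, ?_, ?_, ?_⟩
  · simp [letters, List.getD_eq_getElem?_getD]
  · simp [letters, List.getD_eq_getElem?_getD, add_assoc]
  · rw [block_letters (by simp; omega)]
    simp [List.drop_append, List.drop_of_length_le]

/-- every left special trapezoidal word is Sturmian. -/
theorem left_special_trapezoidal_is_sturmian (w : Word)
    (htrap : IsTrapezoidal w)
    (ha : IsTrapezoidal (AB.a :: w)) (hb : IsTrapezoidal (AB.b :: w)) :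
    IsSturmian w := by
  rintro ⟨u, hua, hub⟩
  obtain ⟨p, hp, hpa, hpa', hpu⟩ := exists_position_of_isInfix hua
  obtain ⟨q, hq, hqb, hqb', hqu⟩ := exists_position_of_isInfix hub
  refine not_unbalancedAt htrap.rightUnique (fun c => ⟨letters (c :: w), rfl, fun i => rfl, ?_⟩)
    u.length ⟨p, q, hp, hq, by rw [hpa, hpa'], by rw [hqb, hqb'], by simp [hpa, hqb],
      block_eq_iff.mp (hpu.trans hqu.symm)⟩
  cases c
  exacts [ha.rightUnique, hb.rightUnique]
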